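/- For all real d, w > 0, the function σ ↦ V(σ, d, w) is strictly increasing on the interval (0, σ*(d, w)] and strictly decreasing on the interval [σ*(d, w), ∞), where σ*(d, w) = sqrt((2dw + w²) / (2·ln(1 + w/d))). -/

import Mathlib

open Real MeasureTheory

/-- Gaussian density with mean 0 and standard deviation `σ`. -/
noncomputable def gauss (σ x : ℝ) : ℝ :=
  (1 / (σ * Real.sqrt (2 * Real.pi))) * Real.exp (-x ^ 2 / (2 * σ ^ 2))

/-- The value function: probability that a `N(0, σ²)` variable lies in `[d, d+w]`. -/
noncomputable def V (σ d w : ℝ) : ℝ := ∫ x in d..(d + w), gauss σ x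

/-- The claimed optimal standard deviation. -/
noncomputable def sigmaStar (d w : ℝ) : ℝ :=
  Real.sqrt ((2 * d * w + w ^ 2) / (2 * Real.log (1 + w / d)))

lemma continuous_gauss (σ : ℝ) : Continuous (gauss σ) := by
  unfold gauss
  fun_prop

lemma V_eq_integral_standard {σ : ℝ} (hσ : 0 < σ) (d w : ℝ) :
    V σ d w = (∫ x in (0 : ℝ)..((d + w) / σ), gauss 1 x) - ∫ x in (0 : ℝ)..(d / σ), gauss 1 x := by
  have hint (a b : ℝ) : IntervalIntegrable (gauss 1) volume a b :=
    (continuous_gauss 1).intervalIntegrable a b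
  rw [intervalIntegral.integral_interval_sub_left (hint _ _) (hint _ _),
    ← intervalIntegral.inv_smul_integral_comp_div, smul_eq_mul,
    ← intervalIntegral.integral_const_mul, V]
  congr 1
  ext x
  have hexp : -x ^ 2 / (2 * σ ^ 2) = -(x / σ) ^ 2 / (2 * 1 ^ 2) := by
    field_simp
  rw [gauss, gauss, hexp, one_mul]
  field_simp

lemma hasDerivAt_V {σ : ℝ} (hσ : 0 < σ) (d w : ℝ) :
    HasDerivAt (fun s => V s d w)
      ((d * gauss 1 (d / σ) - (d + w) * gauss 1 ((d + w) / σ)) / σ ^ 2) σ := by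
  have hcdf (a : ℝ) : HasDerivAt (fun s => ∫ x in (0 : ℝ)..(a / s), gauss 1 x)
      (gauss 1 (a / σ) * (-a / σ ^ 2)) σ := by
    have hdiv : HasDerivAt (fun s => a / s) (-a / σ ^ 2) σ := by
      simpa using (hasDerivAt_const σ a).fun_div (hasDerivAt_id' σ) hσ.ne'
    exact ((continuous_gauss 1).integral_hasStrictDerivAt 0 (a / σ)).hasDerivAt.comp σ hdiv
  have hsub := (hcdf (d + w)).sub (hcdf d)
  refine (hsub.congr_deriv (by ring)).congr_of_eventuallyEq ?_
  filter_upwards [lt_mem_nhds hσ] with s hs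
  exact V_eq_integral_standard hs d w

lemma mul_gauss_one_div {a : ℝ} (ha : 0 < a) (σ : ℝ) :
    a * gauss 1 (a / σ) =
      (1 / Real.sqrt (2 * Real.pi)) * Real.exp (Real.log a - a ^ 2 / (2 * σ ^ 2)) := by
  have hexp : -(a / σ) ^ 2 / (2 * 1 ^ 2) = -(a ^ 2 / (2 * σ ^ 2)) := by
    ring
  rw [gauss, hexp, sub_eq_add_neg, Real.exp_add, Real.exp_log ha]
  ring

lemma mul_gauss_one_div_lt_iff {a b : ℝ} (ha : 0 < a) (hb : 0 < b) (σ : ℝ) :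
    a * gauss 1 (a / σ) < b * gauss 1 (b / σ) ↔
      Real.log a - a ^ 2 / (2 * σ ^ 2) < Real.log b - b ^ 2 / (2 * σ ^ 2) := by
  have hc : 0 < 1 / Real.sqrt (2 * Real.pi) := by positivity
  rw [mul_gauss_one_div ha, mul_gauss_one_div hb, mul_lt_mul_iff_right₀ hc, Real.exp_lt_exp]

lemma log_one_add_div {d w : ℝ} (hd : 0 < d) (hw : 0 < w) :
    Real.log (1 + w / d) = Real.log (d + w) - Real.log d := by
  rw [one_add_div hd.ne', Real.log_div (by positivity) hd.ne']

lemma log_one_add_div_pos {d w : ℝ} (hd : 0 < d) (hw : 0 < w) :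
    0 < Real.log (1 + w / d) :=
  Real.log_pos (lt_add_of_pos_right 1 (div_pos hw hd))

lemma sigmaStar_pos {d w : ℝ} (hd : 0 < d) (hw : 0 < w) : 0 < sigmaStar d w := by
  have := log_one_add_div_pos hd hw
  unfold sigmaStar
  positivity

lemma deriv_V_pos {σ d w : ℝ} (hd : 0 < d) (hw : 0 < w) (hσ : 0 < σ)
    (h : σ < sigmaStar d w) : 0 < deriv (fun s => V s d w) σ := by
  rw [(hasDerivAt_V hσ d w).deriv]
  refine div_pos (sub_pos.2 ((mul_gauss_one_div_lt_iff (by positivity) hd σ).2 ?_)) (by positivity)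
  have hL := log_one_add_div_pos hd hw
  rw [sigmaStar, Real.lt_sqrt hσ.le, lt_div_iff₀ (by positivity)] at h
  have hlog : Real.log (1 + w / d) < (2 * d * w + w ^ 2) / (2 * σ ^ 2) := by
    rw [lt_div_iff₀ (by positivity)]
    linarith
  rw [log_one_add_div hd hw] at hlog
  have hsplit : (d + w) ^ 2 / (2 * σ ^ 2) =
      d ^ 2 / (2 * σ ^ 2) + (2 * d * w + w ^ 2) / (2 * σ ^ 2) := by ring
  linarith

lemma deriv_V_neg {σ d w : ℝ} (hd : 0 < d) (hw : 0 < w)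
    (h : sigmaStar d w < σ) : deriv (fun s => V s d w) σ < 0 := by
  have hσ : 0 < σ := (sigmaStar_pos hd hw).trans h
  rw [(hasDerivAt_V hσ d w).deriv]
  refine div_neg_of_neg_of_pos
    (sub_neg.2 ((mul_gauss_one_div_lt_iff hd (by positivity) σ).2 ?_)) (by positivity)
  have hL := log_one_add_div_pos hd hw
  rw [sigmaStar, Real.sqrt_lt' hσ, div_lt_iff₀ (by positivity)] at h
  have hlog : (2 * d * w + w ^ 2) / (2 * σ ^ 2) < Real.log (1 + w / d) := by
    rw [div_lt_iff₀ (by positivity)]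
    linarith
  rw [log_one_add_div hd hw] at hlog
  have hsplit : (d + w) ^ 2 / (2 * σ ^ 2) =
      d ^ 2 / (2 * σ ^ 2) + (2 * d * w + w ^ 2) / (2 * σ ^ 2) := by ring
  linarith

theorem V_strictMono_then_strictAnti (d w : ℝ) (hd : 0 < d) (hw : 0 < w) :
    StrictMonoOn (fun σ => V σ d w) (Set.Ioc 0 (sigmaStar d w)) ∧
    StrictAntiOn (fun σ => V σ d w) (Set.Ici (sigmaStar d w)) := by
  constructor
  · refine strictMonoOn_of_deriv_pos (convex_Ioc _ _)
      (fun σ hσ => (hasDerivAt_V hσ.1 d w).continuousAt.continuousWithinAt) fun σ hσ => ?_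
    rw [interior_Ioc] at hσ
    exact deriv_V_pos hd hw hσ.1 hσ.2
  · refine strictAntiOn_of_deriv_neg (convex_Ici _)
      (fun σ hσ => (hasDerivAt_V ((sigmaStar_pos hd hw).trans_le hσ)
        d w).continuousAt.continuousWithinAt) fun σ hσ => ?_
    rw [interior_Ici] at hσ
    exact deriv_V_neg hd hw hσ
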